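/- Let d ≥ 1, β, α₁, α₂ > 0 and a₁, a₂ ∈ ℝ^d, and for a probability measure μ on ℝ^d with ∫|y − a₁|³ dμ(y) < ∞ define b(x, μ) = −(β/2)[ (x − a₁)|x − a₂|² + (x − a₂)|x − a₁|² ] − ∫ ( α₁ |x − y|² (x − y) + α₂ (x − y) ) dμ(y). Write m₁ = ∫|y − a₁| dμ(y) and m₃ = ∫|y − a₁|³ dμ(y). Then for every such μ and every x ∈ ℝ^d: 2⟨b(x + a₁, μ), x⟩ ≤ −2β[ (1 + α₁/β)|x|⁴ − 3(|a₁ − a₂| + (α₁/β) m₁)|x|³ + (|a₁ − a₂|²/2 + (α₁/β) m₁² + α₂/β)|x|² − ((α₁/β) m₃ + (α₂/β) m₁)|x| ]. -/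

import Mathlib

open MeasureTheory RealInnerProductSpace

section Helpers

variable {E : Type*} [NormedAddCommGroup E] [InnerProductSpace ℝ E]

/-- Pointwise lower bound for the cubic interaction; the last square is linearised around `m`. -/
lemma cubic_interaction_lower_bound (x z : E) (m : ℝ) :
    ‖x‖ ^ 4 - 3 * ‖x‖ ^ 3 * ‖z‖ + ‖x‖ ^ 2 * (2 * m * ‖z‖ - m ^ 2) - ‖x‖ * ‖z‖ ^ 3
      ≤ ‖x - z‖ ^ 2 * ⟪x, x - z⟫ := by
  rw [norm_sub_sq_real, inner_sub_right, real_inner_self_eq_norm_sq]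
  have hc := real_inner_le_norm x z
  nlinarith [mul_le_mul_of_nonneg_left hc (sq_nonneg ‖x‖),
    mul_le_mul_of_nonneg_left hc (sq_nonneg ‖z‖), sq_nonneg ⟪x, z⟫,
    mul_nonneg (sq_nonneg ‖x‖) (sq_nonneg (‖z‖ - m))]

lemma linear_interaction_lower_bound (x z : E) :
    ‖x‖ ^ 2 - ‖x‖ * ‖z‖ ≤ ⟪x, x - z⟫ := by
  rw [inner_sub_right, real_inner_self_eq_norm_sq]
  linarith [real_inner_le_norm x z]

/-- Upper bound for the confining part of the drift. -/
lemma confinement_upper_bound (x v : E) {β : ℝ} (hβ : 0 ≤ β) :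
    2 * ⟪-((β / 2) • (‖x + v‖ ^ 2 • x + ‖x‖ ^ 2 • (x + v))), x⟫ ≤
      -2 * β * (‖x‖ ^ 4 - 3 * ‖v‖ * ‖x‖ ^ 3 + ‖v‖ ^ 2 / 2 * ‖x‖ ^ 2) := by
  simp only [inner_neg_left, inner_add_left, real_inner_smul_left, norm_add_sq_real,
    real_inner_self_eq_norm_sq, real_inner_comm x v]
  have hc : -(‖x‖ * ‖v‖) ≤ ⟪x, v⟫ := neg_le_of_abs_le (abs_real_inner_le_norm x v)
  have h₁ := mul_le_mul_of_nonneg_left hc (mul_nonneg hβ (sq_nonneg ‖x‖))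
  have h₂ : 0 ≤ β * (‖x‖ ^ 3 * ‖v‖) := by positivity
  nlinarith

lemma integrable_norm_sub_of_cube {F : Type*} [NormedAddCommGroup F] [MeasurableSpace F]
    [BorelSpace F] [SecondCountableTopology F] {μ : Measure F} [IsFiniteMeasure μ] {a : F}
    (hμ : Integrable (fun y => ‖y - a‖ ^ 3) μ) :
    Integrable (fun y => ‖y - a‖) μ := by
  refine ((integrable_const (1 : ℝ)).add hμ).mono' (by fun_prop) (.of_forall fun y => ?_)
  simp only [norm_norm, Pi.add_apply]
  have h := norm_nonneg (y - a)
  nlinarith [mul_nonneg h (sq_nonneg (‖y - a‖ - 1)), sq_nonneg (‖y - a‖ - 1)]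

variable [MeasurableSpace E] [BorelSpace E] [SecondCountableTopology E] {μ : Measure E} {a : E}

lemma integrable_interaction [IsFiniteMeasure μ]
    (hμ : Integrable (fun y => ‖y - a‖ ^ 3) μ) (α₁ α₂ : ℝ) (x : E) :
    Integrable (fun y => (α₁ * ‖x - y‖ ^ 2) • (x - y) + α₂ • (x - y)) μ := by
  have hsub (y : E) : ‖x - y‖ ≤ ‖x - a‖ + ‖y - a‖ := by
    simpa using norm_sub_le (x - a) (y - a)
  have hlin : Integrable (fun y => x - y) μ :=
    ((integrable_const ‖x - a‖).add (integrable_norm_sub_of_cube hμ)).mono' (by fun_prop)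
      (.of_forall hsub)
  refine Integrable.add ?_ (hlin.smul α₂)
  refine (((integrable_const (‖x - a‖ ^ 3)).add hμ).const_mul (|α₁| * 4)).mono'
    (by fun_prop) (.of_forall fun y => ?_)
  have hpow : ‖x - y‖ ^ 3 ≤ 4 * (‖x - a‖ ^ 3 + ‖y - a‖ ^ 3) := by
    have h := add_pow_le (norm_nonneg (x - a)) (norm_nonneg (y - a)) 3
    norm_num at h
    exact (pow_le_pow_left₀ (norm_nonneg _) (hsub y) 3).trans h
  calc ‖(α₁ * ‖x - y‖ ^ 2) • (x - y)‖ = |α₁| * ‖x - y‖ ^ 3 := by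
        rw [norm_smul, norm_mul, norm_pow, norm_norm, Real.norm_eq_abs]; ring
    _ ≤ |α₁| * 4 * (‖x - a‖ ^ 3 + ‖y - a‖ ^ 3) := by
        rw [mul_assoc]; exact mul_le_mul_of_nonneg_left hpow (abs_nonneg _)

/-- Lower bound for the interaction part of the drift. -/
lemma interaction_lower_bound [CompleteSpace E] [IsProbabilityMeasure μ]
    (hμ : Integrable (fun y => ‖y - a‖ ^ 3) μ) {α₁ α₂ : ℝ} (hα₁ : 0 ≤ α₁) (hα₂ : 0 ≤ α₂) (x : E) :
    α₁ * (‖x‖ ^ 4 - 3 * ‖x‖ ^ 3 * (∫ y, ‖y - a‖ ∂μ) + ‖x‖ ^ 2 * (∫ y, ‖y - a‖ ∂μ) ^ 2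
        - ‖x‖ * ∫ y, ‖y - a‖ ^ 3 ∂μ)
      + α₂ * (‖x‖ ^ 2 - ‖x‖ * ∫ y, ‖y - a‖ ∂μ) ≤
    ⟪∫ y, ((α₁ * ‖x + a - y‖ ^ 2) • (x + a - y) + α₂ • (x + a - y)) ∂μ, x⟫ := by
  have hint := integrable_interaction hμ α₁ α₂ (x + a)
  have h₁ := integrable_norm_sub_of_cube hμ
  rw [real_inner_comm, ← integral_inner hint]
  set m := ∫ y, ‖y - a‖ ∂μ with hm
  -- the pointwise lower bound, collected as an affine function of `‖y - a‖` and `‖y - a‖ ^ 3`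
  let A := α₁ * (‖x‖ ^ 4 - ‖x‖ ^ 2 * m ^ 2) + α₂ * ‖x‖ ^ 2
  let B := α₁ * (-3 * ‖x‖ ^ 3 + 2 * m * ‖x‖ ^ 2) - α₂ * ‖x‖
  let C := -(α₁ * ‖x‖)
  have hB : Integrable (fun y => A + B * ‖y - a‖) μ :=
    (integrable_const A).add (h₁.const_mul B)
  have hC : Integrable (fun y => C * ‖y - a‖ ^ 3) μ := hμ.const_mul C
  calc _ = ∫ y, (A + B * ‖y - a‖ + C * ‖y - a‖ ^ 3) ∂μ := by
        rw [integral_add hB hC, integral_add (integrable_const A) (h₁.const_mul B),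
          integral_const_mul, integral_const_mul, ← hm]
        simp only [integral_const, probReal_univ, one_smul, A, B, C]
        ring
    _ ≤ _ := by
        refine integral_mono (hB.add hC) (hint.const_inner x) fun y => ?_
        have hxy : x + a - y = x - (y - a) := by abel
        simp only [hxy, inner_add_right, real_inner_smul_right, A, B, C]
        linear_combination
          mul_le_mul_of_nonneg_left (cubic_interaction_lower_bound x (y - a) m) hα₁
            + mul_le_mul_of_nonneg_left (linear_interaction_lower_bound x (y - a)) hα₂

end Helpers

/-- Drift dissipativity estimate of Example 2.2 (non-quadratic interaction),
shifted to the point `a₁`, for the McKean–Vlasov drift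
`b(x, μ) = −(β/2)[(x−a₁)|x−a₂|² + (x−a₂)|x−a₁|²]
           − ∫ (α₁|x−y|²(x−y) + α₂(x−y)) dμ(y)`. -/
theorem example22_drift (d : ℕ) (hd : 1 ≤ d) (β α₁ α₂ : ℝ)
    (hβ : 0 < β) (hα₁ : 0 < α₁) (hα₂ : 0 < α₂)
    (a₁ a₂ : EuclideanSpace ℝ (Fin d))
    (μ : Measure (EuclideanSpace ℝ (Fin d))) [IsProbabilityMeasure μ]
    (hμ : Integrable (fun y => ‖y - a₁‖ ^ 3) μ)
    (b : EuclideanSpace ℝ (Fin d) → EuclideanSpace ℝ (Fin d))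
    (hb : ∀ x : EuclideanSpace ℝ (Fin d),
      b x = -((β / 2) • (‖x - a₂‖ ^ 2 • (x - a₁) + ‖x - a₁‖ ^ 2 • (x - a₂)))
        - ∫ y, ((α₁ * ‖x - y‖ ^ 2) • (x - y) + α₂ • (x - y)) ∂μ)
    (x : EuclideanSpace ℝ (Fin d)) :
    2 * ⟪b (x + a₁), x⟫ ≤
      -2 * β * ((1 + α₁ / β) * ‖x‖ ^ 4
        - 3 * (‖a₁ - a₂‖ + (α₁ / β) * ∫ y, ‖y - a₁‖ ∂μ) * ‖x‖ ^ 3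
        + (‖a₁ - a₂‖ ^ 2 / 2 + (α₁ / β) * (∫ y, ‖y - a₁‖ ∂μ) ^ 2 + α₂ / β) * ‖x‖ ^ 2
        - ((α₁ / β) * (∫ y, ‖y - a₁‖ ^ 3 ∂μ)
            + (α₂ / β) * ∫ y, ‖y - a₁‖ ∂μ) * ‖x‖) := by
  have hconf := confinement_upper_bound x (a₁ - a₂) hβ.le
  have hint := interaction_lower_bound hμ hα₁.le hα₂.le x
  have hx : x + a₁ - a₂ = x + (a₁ - a₂) := by abel
  rw [hb, inner_sub_left, add_sub_cancel_right, hx]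
  calc _ ≤ -2 * β * (‖x‖ ^ 4 - 3 * ‖a₁ - a₂‖ * ‖x‖ ^ 3 + ‖a₁ - a₂‖ ^ 2 / 2 * ‖x‖ ^ 2)
      - 2 * (α₁ * (‖x‖ ^ 4 - 3 * ‖x‖ ^ 3 * (∫ y, ‖y - a₁‖ ∂μ)
          + ‖x‖ ^ 2 * (∫ y, ‖y - a₁‖ ∂μ) ^ 2 - ‖x‖ * ∫ y, ‖y - a₁‖ ^ 3 ∂μ)
        + α₂ * (‖x‖ ^ 2 - ‖x‖ * ∫ y, ‖y - a₁‖ ∂μ)) := by linarith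
    _ = _ := by
      field_simp
      ring
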